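/- arXiv:2511.05198 — 2 statements merged into one kernel-verified Lean document; each statement's English description precedes it below -/
import Mathlib

section
/- Let L be a totally real number field and let χ be an algebraic Hecke character of L modulo a nonzero ideal 𝔣 with infinity type μ ∈ ℤ^{J_L}. Then χ is of the form χ = ρ·N(·)^k: there exist an integer k and a group homomorphism ρ : I(𝔣) → ℂ^× with finite image such that χ(𝔞) = ρ(𝔞)·N(𝔞)^k for every 𝔞 ∈ I(𝔣), where N(𝔞) denotes the absolute ideal norm of 𝔞. -/
open NumberField FractionalIdeal
open scoped nonZeroDivisors

variable (L : Type*) [Field L] [NumberField L]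

/-- The group `I(𝔣)` of fractional ideals of `L` coprime to `𝔣`: the subgroup of invertible
fractional ideals generated by the integral ideals coprime to `𝔣`. -/
noncomputable def idealsCoprimeTo (𝔣 : Ideal (𝓞 L)) :
    Subgroup (FractionalIdeal (𝓞 L)⁰ L)ˣ :=
  Subgroup.closure
    {I : (FractionalIdeal (𝓞 L)⁰ L)ˣ |
      ∃ a : Ideal (𝓞 L), IsCoprime a 𝔣 ∧ (I : FractionalIdeal (𝓞 L)⁰ L) = a}

/-- `ξ ≡ 1 (mod^× 𝔣)`: `ξ` is a quotient `a/b` of elements of `𝒪_L` that are both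
congruent to `1` modulo `𝔣`. -/
def MulCongruentOne (𝔣 : Ideal (𝓞 L)) (ξ : L) : Prop :=
  ∃ a b : 𝓞 L, a - 1 ∈ 𝔣 ∧ b - 1 ∈ 𝔣 ∧ algebraMap (𝓞 L) L b ≠ 0 ∧
    ξ = algebraMap (𝓞 L) L a / algebraMap (𝓞 L) L b

/-- `χ : I(𝔣) → ℂ^×` is an algebraic Hecke character modulo `𝔣` with infinity type
`μ ∈ ℤ^{J_L}` if for every principal fractional ideal `(ξ)` with `ξ ≡ 1 (mod^× 𝔣)` and
`σ(ξ) > 0` for all real embeddings `σ`, one has `χ((ξ)) = ∏_σ σ(ξ)^{μ(σ)}`. -/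
def IsAlgebraicHeckeCharacter (𝔣 : Ideal (𝓞 L)) (μ : (L →+* ℂ) → ℤ)
    (χ : idealsCoprimeTo L 𝔣 →* ℂˣ) : Prop :=
  ∀ (ξ : Lˣ) (h : toPrincipalIdeal (𝓞 L) L ξ ∈ idealsCoprimeTo L 𝔣),
    MulCongruentOne L 𝔣 (ξ : L) →
    (∀ σ : L →+* ℂ, ComplexEmbedding.IsReal σ → 0 < (σ (ξ : L)).re) →
    (χ ⟨_, h⟩ : ℂ) = ∏ σ : L →+* ℂ, σ (ξ : L) ^ μ σ

variable {L}

lemma exists_pow_sub_one_mem {𝔣 : Ideal (𝓞 L)} (h𝔣 : 𝔣 ≠ 0) :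
    ∃ m : ℕ, 0 < m ∧ ∀ x : 𝓞 L, IsUnit (Ideal.Quotient.mk 𝔣 x) → x ^ m - 1 ∈ 𝔣 := by
  have : Finite (𝓞 L ⧸ 𝔣) := Ideal.finiteQuotientOfFreeOfNeBot 𝔣 h𝔣
  refine ⟨Nat.card (𝓞 L ⧸ 𝔣)ˣ, Nat.card_pos, fun x hx => ?_⟩
  obtain ⟨u, hu⟩ := hx
  rw [← Ideal.Quotient.eq, map_pow, ← hu, ← Units.val_pow_eq_pow_val, pow_card_eq_one',
    Units.val_one, map_one]

lemma coe_norm_eq_prod_embeddings (x : L) :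
    ((Algebra.norm ℚ x : ℚ) : ℂ) = ∏ σ : L →+* ℂ, σ x := by
  rw [← Fintype.prod_equiv (RingHom.equivRatAlgHom (R := L) (S := ℂ)).symm (fun f => f x)
    (fun σ => σ x) fun _ => rfl]
  exact Algebra.norm_eq_prod_embeddings ℚ ℂ x

lemma sum_log_norm_embedding_unit (u : (𝓞 L)ˣ) :
    ∑ σ : L →+* ℂ, Real.log ‖σ (u : L)‖ = 0 := by
  have hu : ∀ σ : L →+* ℂ, ‖σ (u : L)‖ ≠ 0 := fun σ => by simp
  have h := NumberField.Units.norm L u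
  rw [← Real.log_prod fun σ _ => hu σ, ← norm_prod, ← coe_norm_eq_prod_embeddings,
    Complex.norm_ratCast, ← Rat.cast_abs, h]
  simp

lemma re_embedding_pow_pos {K : Type*} [Field K] {σ : K →+* ℂ}
    (hσ : ComplexEmbedding.IsReal σ) {x : K} (hx : x ≠ 0) {n : ℕ} (hn : Even n) :
    0 < (σ (x ^ n)).re := by
  rw [← hσ.coe_embedding_apply, Complex.ofReal_re, map_pow]
  exact hn.pow_pos ((_root_.map_ne_zero _).mpr hx)

/-- The value of a Hecke character on an ideal generated by an even power of an algebraic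
integer, that power being congruent to `1` modulo `𝔣`. -/
lemma IsAlgebraicHeckeCharacter.apply_pow {𝔣 : Ideal (𝓞 L)} {μ : (L →+* ℂ) → ℤ}
    {χ : idealsCoprimeTo L 𝔣 →* ℂˣ} (hχ : IsAlgebraicHeckeCharacter L 𝔣 μ χ)
    {x : 𝓞 L} (hx : x ≠ 0) {n : ℕ} (hn : Even n) (hx1 : x ^ n - 1 ∈ 𝔣)
    {I : idealsCoprimeTo L 𝔣}
    (hI : ((I : (FractionalIdeal (𝓞 L)⁰ L)ˣ) : FractionalIdeal (𝓞 L)⁰ L) =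
      spanSingleton (𝓞 L)⁰ ((x : L) ^ n)) :
    (χ I : ℂ) = ∏ σ : L →+* ℂ, σ ((x : L) ^ n) ^ μ σ := by
  have hxL : (x : L) ≠ 0 := RingOfIntegers.coe_ne_zero_iff.mpr hx
  have hI' : toPrincipalIdeal (𝓞 L) L (Units.mk0 ((x : L) ^ n) (pow_ne_zero n hxL)) = I := by
    rw [toPrincipalIdeal_eq_iff, hI, Units.val_mk0]
  obtain ⟨I, hmem⟩ := I
  subst hI'
  exact hχ _ hmem ⟨x ^ n, 1, hx1, by simp, by simp, by simp⟩
    fun σ hσ => re_embedding_pow_pos hσ hxL hn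

/-- The infinity type kills the logarithms of units. -/
lemma IsAlgebraicHeckeCharacter.sum_mul_log_unit {𝔣 : Ideal (𝓞 L)} (h𝔣 : 𝔣 ≠ 0)
    {μ : (L →+* ℂ) → ℤ} {χ : idealsCoprimeTo L 𝔣 →* ℂˣ}
    (hχ : IsAlgebraicHeckeCharacter L 𝔣 μ χ) (u : (𝓞 L)ˣ) :
    ∑ σ : L →+* ℂ, (μ σ : ℝ) * Real.log ‖σ (u : L)‖ = 0 := by
  obtain ⟨m, hm, hpow⟩ := exists_pow_sub_one_mem h𝔣
  have h1 : ((u ^ 2 : (𝓞 L)ˣ) : 𝓞 L) ^ m - 1 ∈ 𝔣 := hpow _ ((u ^ 2).isUnit.map _)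
  rw [Units.val_pow_eq_pow_val, ← pow_mul] at h1
  have hspan : spanSingleton (𝓞 L)⁰ (((u : 𝓞 L) : L) ^ (2 * m)) = 1 := by
    rw [← map_pow, ← coeIdeal_span_singleton,
      Ideal.span_singleton_eq_top.mpr (u.isUnit.pow _), coeIdeal_top]
  have h := hχ.apply_pow (I := 1) u.ne_zero (even_two_mul m) h1 (by simpa using hspan.symm)
  have hu : ∀ σ : L →+* ℂ, ‖σ (u : L)‖ ≠ 0 := fun σ => by simp
  replace h := congrArg (fun z : ℂ => Real.log ‖z‖) h
  simp only [map_one, Units.val_one, norm_one, Real.log_one, norm_prod, norm_zpow, map_pow,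
    norm_pow] at h
  rw [Real.log_prod fun σ _ => zpow_ne_zero _ (pow_ne_zero _ (hu σ))] at h
  simp only [Real.log_zpow, Real.log_pow] at h
  have h2 : ((2 * m : ℕ) : ℝ) ≠ 0 := by positivity
  refine (mul_eq_zero.mp ?_).resolve_left h2
  rw [Finset.mul_sum, h]
  exact Finset.sum_congr rfl fun σ _ => by ring

/-- Over a totally real field the infinity type of an algebraic Hecke character is parallel. -/
lemma IsAlgebraicHeckeCharacter.exists_infinityType_eq
    (hreal : ∀ σ : L →+* ℂ, ComplexEmbedding.IsReal σ) {𝔣 : Ideal (𝓞 L)} (h𝔣 : 𝔣 ≠ 0)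
    {μ : (L →+* ℂ) → ℤ} {χ : idealsCoprimeTo L 𝔣 →* ℂˣ}
    (hχ : IsAlgebraicHeckeCharacter L 𝔣 μ χ) : ∃ k : ℤ, ∀ σ, μ σ = k := by
  obtain ⟨τ, hτ⟩ := Finite.exists_min μ
  obtain ⟨u, hu⟩ := NumberField.Units.dirichletUnitTheorem.exists_unit L (InfinitePlace.mk τ)
  have hlog : ∀ σ, σ ≠ τ → Real.log ‖σ (u : L)‖ < 0 := fun σ hσ => by
    refine hu (InfinitePlace.mk σ) fun h => hσ ?_
    rwa [InfinitePlace.mk_eq_iff, ComplexEmbedding.isReal_iff.mp (hreal σ), or_self] at h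
  have hsum : ∑ σ : L →+* ℂ, ((μ σ : ℝ) - μ τ) * Real.log ‖σ (u : L)‖ = 0 := by
    simp only [sub_mul, Finset.sum_sub_distrib, ← Finset.mul_sum, hχ.sum_mul_log_unit h𝔣,
      sum_log_norm_embedding_unit, mul_zero, sub_zero]
  have hnonpos : ∀ σ ∈ Finset.univ, ((μ σ : ℝ) - μ τ) * Real.log ‖σ (u : L)‖ ≤ 0 := by
    intro σ _
    rcases eq_or_ne σ τ with rfl | hσ
    · simp
    · exact mul_nonpos_of_nonneg_of_nonpos (sub_nonneg.mpr (by exact_mod_cast hτ σ)) (hlog σ hσ).le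
  refine ⟨μ τ, fun σ => ?_⟩
  rcases eq_or_ne σ τ with rfl | hσ
  · rfl
  · have h := (Finset.sum_eq_zero_iff_of_nonpos hnonpos).mp hsum σ (Finset.mem_univ σ)
    exact_mod_cast sub_eq_zero.mp ((mul_eq_zero.mp h).resolve_right (hlog σ hσ).ne)

/-- A uniform power of an ideal coprime to `𝔣` is generated by an even power of an integer,
congruent to `1` modulo `𝔣`. -/
lemma exists_pow_eq_span_singleton {𝔣 : Ideal (𝓞 L)} (h𝔣 : 𝔣 ≠ 0) :
    ∃ n h : ℕ, 0 < n ∧ 0 < h ∧ Even n ∧ ∀ a : Ideal (𝓞 L), a ≠ 0 → IsCoprime a 𝔣 →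
      ∃ x : 𝓞 L, x ≠ 0 ∧ x ^ n - 1 ∈ 𝔣 ∧ a ^ (h * n) = Ideal.span {x ^ n} := by
  obtain ⟨m, hm, hpow⟩ := exists_pow_sub_one_mem h𝔣
  refine ⟨2 * m, Nat.card (ClassGroup (𝓞 L)), by positivity, Nat.card_pos, even_two_mul m,
    fun a ha hcop => ?_⟩
  have ha' : a ∈ (Ideal (𝓞 L))⁰ := mem_nonZeroDivisors_of_ne_zero ha
  obtain ⟨x, hx⟩ := (ClassGroup.mk0_eq_one_iff (pow_mem ha' (Nat.card (ClassGroup (𝓞 L))))).mp (by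
    rw [← SubmonoidClass.mk_pow a ha', map_pow, pow_card_eq_one'])
  replace hx : a ^ Nat.card (ClassGroup (𝓞 L)) = Ideal.span {x} := hx
  refine ⟨x, ?_, ?_, by rw [pow_mul, hx, Ideal.span_singleton_pow]⟩
  · rintro rfl
    exact pow_ne_zero _ ha (hx.trans (by simp))
  · have hc : IsCoprime (Ideal.span {x}) 𝔣 := hx ▸ hcop.pow_left
    obtain ⟨i, hi, j, hj, hij⟩ := Ideal.isCoprime_iff_exists.mp hc
    obtain ⟨c, rfl⟩ := Ideal.mem_span_singleton.mp hi
    have hunit : IsUnit (Ideal.Quotient.mk 𝔣 x) := by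
      refine .of_mul_eq_one (Ideal.Quotient.mk 𝔣 c) ?_
      rw [← map_mul, ← map_one (Ideal.Quotient.mk 𝔣), ← hij, map_add,
        Ideal.Quotient.eq_zero_iff_mem.mpr hj, add_zero]
    rw [pow_mul]
    exact hpow _ (by rw [map_pow]; exact hunit.pow 2)

/-- The absolute norm as a character of `I(𝔣)`. -/
noncomputable def absNormChar (𝔣 : Ideal (𝓞 L)) : idealsCoprimeTo L 𝔣 →* ℂˣ :=
  (Units.map ((algebraMap ℚ ℂ : ℚ →* ℂ).comp
    (FractionalIdeal.absNorm (R := 𝓞 L) (K := L) : FractionalIdeal (𝓞 L)⁰ L →* ℚ))).comp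
    (idealsCoprimeTo L 𝔣).subtype

lemma coe_absNormChar (𝔣 : Ideal (𝓞 L)) (I : idealsCoprimeTo L 𝔣) :
    (absNormChar 𝔣 I : ℂ) =
      ((FractionalIdeal.absNorm ((I : (FractionalIdeal (𝓞 L)⁰ L)ˣ) :
        FractionalIdeal (𝓞 L)⁰ L) : ℚ) : ℂ) := rfl

lemma finite_range_of_pow_eq_one {G F : Type*} [Group G] [Field F] (ρ : G →* Fˣ) {n : ℕ}
    (hn : 0 < n) (h : ∀ g, ρ g ^ n = 1) : (Set.range ρ).Finite := by
  have : NeZero n := ⟨hn.ne'⟩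
  refine Set.Finite.subset (s := (rootsOfUnity n F : Set Fˣ))
    (inferInstanceAs (Finite (rootsOfUnity n F))) ?_
  rintro _ ⟨g, rfl⟩
  exact (mem_rootsOfUnity n _).mpr (h g)

lemma idealsCoprimeTo_hom_pow_eq_one {G : Type*} [CommGroup G] {𝔣 : Ideal (𝓞 L)}
    (ρ : idealsCoprimeTo L 𝔣 →* G) (n : ℕ)
    (h : ∀ (I : idealsCoprimeTo L 𝔣) (a : Ideal (𝓞 L)), IsCoprime a 𝔣 →
      ((I : (FractionalIdeal (𝓞 L)⁰ L)ˣ) : FractionalIdeal (𝓞 L)⁰ L) = a → ρ I ^ n = 1)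
    (I : idealsCoprimeTo L 𝔣) : ρ I ^ n = 1 := by
  obtain ⟨I, hI⟩ := I
  induction hI using Subgroup.closure_induction with
  | mem I hI =>
    obtain ⟨a, ha, hIa⟩ := hI
    exact h _ a ha hIa
  | one => exact (congrArg (· ^ n) (map_one ρ)).trans (one_pow n)
  | mul I J hI hJ ihI ihJ =>
    exact (congrArg (· ^ n) (map_mul ρ ⟨I, hI⟩ ⟨J, hJ⟩)).trans (by rw [mul_pow, ihI, ihJ, one_mul])
  | inv I hI ih =>
    exact (congrArg (· ^ n) (map_inv ρ ⟨I, hI⟩)).trans (by rw [inv_pow, ih, inv_one])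

variable (L)

/-- An algebraic Hecke character of a totally real field is of the form `ρ · N(·)^k` with
`ρ` a group homomorphism of finite image (a finite Hecke character) and `N` the absolute
ideal norm. -/
theorem heckeCharacter_eq_finiteOrderChar_mul_norm_pow_of_totallyReal
    (hreal : ∀ σ : L →+* ℂ, ComplexEmbedding.IsReal σ)
    (𝔣 : Ideal (𝓞 L)) (h𝔣 : 𝔣 ≠ 0)
    (μ : (L →+* ℂ) → ℤ) (χ : idealsCoprimeTo L 𝔣 →* ℂˣ)
    (hχ : IsAlgebraicHeckeCharacter L 𝔣 μ χ) :
    ∃ (k : ℤ) (ρ : idealsCoprimeTo L 𝔣 →* ℂˣ), (Set.range ρ).Finite ∧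
      ∀ 𝔞 : idealsCoprimeTo L 𝔣,
        (χ 𝔞 : ℂ) = (ρ 𝔞 : ℂ) *
          ((FractionalIdeal.absNorm ((𝔞 : (FractionalIdeal (𝓞 L)⁰ L)ˣ) :
              FractionalIdeal (𝓞 L)⁰ L) : ℚ) : ℂ) ^ k := by
  obtain ⟨k, hk⟩ := hχ.exists_infinityType_eq hreal h𝔣
  obtain ⟨n, h, hn, hh, heven, hpow⟩ := exists_pow_eq_span_singleton h𝔣
  refine ⟨k, χ / absNormChar 𝔣 ^ k, finite_range_of_pow_eq_one _ (mul_pos hh hn)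
    (idealsCoprimeTo_hom_pow_eq_one _ _ fun I a hcop hIa => ?_), fun I => ?_⟩
  · have ha : a ≠ 0 := by
      rintro rfl
      exact (I : (FractionalIdeal (𝓞 L)⁰ L)ˣ).ne_zero (hIa.trans (by simp))
    obtain ⟨x, hx, hx1, hspan⟩ := hpow a ha hcop
    have hI : (((I ^ (h * n) : idealsCoprimeTo L 𝔣) : (FractionalIdeal (𝓞 L)⁰ L)ˣ) :
        FractionalIdeal (𝓞 L)⁰ L) = spanSingleton (𝓞 L)⁰ ((x : L) ^ n) := by
      rw [SubgroupClass.coe_pow, Units.val_pow_eq_pow_val, hIa, ← coeIdeal_pow, hspan,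
        coeIdeal_span_singleton, map_pow]
    rw [← map_pow, MonoidHom.div_apply, div_eq_one, Units.ext_iff, MonoidHom.zpow_apply,
      Units.val_zpow_eq_zpow_val, coe_absNormChar, hχ.apply_pow hx heven hx1 hI, hI,
      absNorm_span_singleton, map_pow (Algebra.norm ℚ), abs_of_nonneg (heven.pow_nonneg _),
      ← map_pow (Algebra.norm ℚ),
      coe_norm_eq_prod_embeddings, ← Finset.prod_zpow]
    simp only [hk]
  · rw [← coe_absNormChar, ← Units.val_zpow_eq_zpow_val, ← Units.val_mul, ← MonoidHom.zpow_apply,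
      ← MonoidHom.mul_apply, div_mul_cancel]
end

section
/- Let ρ be a Dirichlet character modulo N with values in ℂ and let k ≥ 1 be an integer satisfying the parity condition ρ(−1) = (−1)^k. Then L(ρ, k)/(2πi)^k is an algebraic number, where L(ρ, s) is the Dirichlet L-function of ρ. -/
open Complex Real

section

open Filter Topology HurwitzZeta ZMod
open scoped Nat

theorem isAlgebraic_exp_two_pi_mul_I_mul_rat (q : ℚ) :
    IsAlgebraic ℚ (cexp (2 * π * I * q)) := by
  refine IsAlgebraic.of_pow q.den_pos ?_
  rw [← Complex.exp_nat_mul]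
  have : (q.den : ℂ) * (2 * π * I * q) = q.num * (2 * π * I) := by
    have h : (q : ℂ) * q.den = q.num := by exact_mod_cast Rat.mul_den_eq_num q
    linear_combination (2 * π * I) * h
  rw [this, Complex.exp_int_mul_two_pi_mul_I]
  exact isAlgebraic_one

theorem isAlgebraic_I : IsAlgebraic ℚ I :=
  .of_pow (n := 2) two_pos (by rw [I_sq]; exact isAlgebraic_one.neg)

theorem isAlgebraic_cot_pi_mul_rat (q : ℚ) : IsAlgebraic ℚ (Complex.cot (π * q)) := by
  rw [Complex.cot_eq_exp_ratio]
  have h := isAlgebraic_exp_two_pi_mul_I_mul_rat q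
  rw [show (2 : ℂ) * I * (π * q) = 2 * π * I * q by ring]
  exact (h.add isAlgebraic_one).mul (isAlgebraic_I.mul (isAlgebraic_one.sub h)).inv

theorem isAlgebraic_bernoulliFun_rat (k : ℕ) (q : ℚ) :
    IsAlgebraic ℚ (bernoulliFun k q : ℂ) := by
  have : (bernoulliFun k q : ℂ) = algebraMap ℚ ℂ ((Polynomial.bernoulli k).eval q) := by
    rw [bernoulliFun, show (q : ℝ) = algebraMap ℚ ℝ q from rfl, Polynomial.eval_map_algebraMap,
      Polynomial.aeval_algebraMap_apply]
    simp
  rw [this]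
  exact isAlgebraic_algebraMap _

theorem DirichletCharacter.isAlgebraic_apply {N : ℕ} [NeZero N] (χ : DirichletCharacter ℂ N)
    (a : ZMod N) : IsAlgebraic ℚ (χ a) := by
  by_cases ha : IsUnit a
  · obtain ⟨u, rfl⟩ := ha
    refine .of_pow (Fintype.card_pos (α := (ZMod N)ˣ)) ?_
    rw [← map_pow, ← Units.val_pow_eq_pow_val, pow_card_eq_one, Units.val_one, map_one]
    exact isAlgebraic_one
  · rw [χ.map_nonunit ha]
    exact isAlgebraic_zero

theorem ZMod.isAlgebraic_stdAddChar {N : ℕ} [NeZero N] (a : ZMod N) :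
    IsAlgebraic ℚ (stdAddChar a : ℂ) := by
  refine .of_pow (NeZero.pos N) ?_
  rw [← AddChar.map_nsmul_eq_pow]
  simpa using isAlgebraic_one

theorem isAlgebraic_finsetSum {ι : Type*} (s : Finset ι) {f : ι → ℂ}
    (h : ∀ i ∈ s, IsAlgebraic ℚ (f i)) : IsAlgebraic ℚ (∑ i ∈ s, f i) :=
  (Subalgebra.algebraicClosure ℚ ℂ).sum_mem h

/-- At an integer `k ≥ 2`, the part of parity `k` of the exponential zeta function is a Bernoulli
polynomial. -/
theorem expZeta_add_expZeta_neg {k : ℕ} (hk : 2 ≤ k) {x : ℝ} (hx : x ∈ Set.Icc (0 : ℝ) 1) :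
    expZeta (x : UnitAddCircle) k + (-1) ^ k * expZeta (-x : UnitAddCircle) k =
      -(2 * π * I) ^ k / k ! * bernoulliFun k x := by
  have hk' : 1 < re (k : ℂ) := by simpa using! hk
  have h₁ := hasSum_expZeta_of_one_lt_re x hk'
  have h₂ := (hasSum_expZeta_of_one_lt_re (-x) hk').mul_left ((-1) ^ k)
  rw [AddCircle.coe_neg] at h₂
  refine (h₁.add h₂).unique ((hasSum_one_div_nat_pow_mul_fourier hk hx).congr_fun fun n ↦ ?_)
  simp only [fourier_coe_apply, cpow_natCast]
  push_cast
  rw [show 2 * π * I * n * x / 1 = 2 * π * I * x * n by ring,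
    show 2 * π * I * (-n) * x / 1 = 2 * π * I * (-x) * n by ring]
  ring

theorem Real.abs_rpow_neg_sub_rpow_neg_le {m a b s : ℝ} (hm : 0 < m) (ha : m ≤ a) (hb : m ≤ b)
    (hs : 0 ≤ s) : |a ^ (-s) - b ^ (-s)| ≤ s * m ^ (-s - 1) * |a - b| := by
  have := (convex_Ici m).norm_image_sub_le_of_norm_hasDerivWithin_le (f := fun t ↦ t ^ (-s))
    (f' := fun t ↦ -s * t ^ (-s - 1)) (C := s * m ^ (-s - 1)) (x := b) (y := a)
    (fun t ht ↦ (Real.hasDerivAt_rpow_const (.inl (hm.trans_le ht).ne')).hasDerivWithinAt)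
    (fun t ht ↦ ?_) hb ha
  · simpa using this
  · have ht' : 0 < t := hm.trans_le ht
    rw [norm_mul, norm_neg, Real.norm_of_nonneg hs, Real.norm_of_nonneg (by positivity)]
    exact mul_le_mul_of_nonneg_left
      (Real.rpow_le_rpow_of_nonpos hm ht (by linarith)) hs

/-- The odd Hurwitz zeta function at `s = 1` is a cotangent, by continuity of its Dirichlet series
from the right and the Mittag-Leffler expansion. -/
theorem hurwitzZetaOdd_one {x : ℝ} (hx : x ∈ Set.Ioo (0 : ℝ) 1) :
    hurwitzZetaOdd (x : UnitAddCircle) 1 = π / 2 * Complex.cot (π * x) := by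
  let f (s : ℝ) (n : ℕ) : ℂ := (1 / (n + x : ℂ) ^ (s : ℂ) - 1 / (n + 1 - x : ℂ) ^ (s : ℂ)) / 2
  obtain ⟨c, hc, hcx, hcx'⟩ : ∃ c : ℝ, 0 < c ∧ c ≤ x ∧ c ≤ 1 - x :=
    ⟨min x (1 - x), lt_min hx.1 (by linarith [hx.2]), min_le_left .., min_le_right ..⟩
  have hc1 : c ≤ 1 := hcx.trans hx.2.le
  let bd (n : ℕ) : ℝ := 2 * c ^ (-3 : ℝ) * (1 / ((n + 1 : ℕ) : ℝ) ^ 2)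
  have hbd : Summable bd :=
    ((summable_nat_add_iff 1).mpr (Real.summable_one_div_nat_pow.mpr one_lt_two)).mul_left _
  have hle {s : ℝ} (hs : s ∈ Set.Icc (1 : ℝ) 2) (n : ℕ) : ‖f s n‖ ≤ bd n := by
    have hn : (0 : ℝ) ≤ n := n.cast_nonneg
    have hm : 0 < c * (n + 1) := by positivity
    have h1 : c * (n + 1) ≤ n + x := by nlinarith
    have h2 : c * (n + 1) ≤ n + 1 - x := by nlinarith
    have hf : f s n = (((n + x) ^ (-s) - (n + 1 - x) ^ (-s) : ℝ) / 2 : ℂ) := by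
      simp only [f]
      rw [Real.rpow_neg (hm.le.trans h1), Real.rpow_neg (hm.le.trans h2)]
      push_cast [Complex.ofReal_cpow (hm.le.trans h1), Complex.ofReal_cpow (hm.le.trans h2)]
      simp only [one_div]
    rw [hf, norm_div, Complex.norm_real, Real.norm_eq_abs]
    have h3 := Real.abs_rpow_neg_sub_rpow_neg_le hm h1 h2 (zero_le_one.trans hs.1)
    have h4 : |n + x - (n + 1 - x)| ≤ 1 := by
      rw [abs_le]; constructor <;> linarith [hx.1, hx.2]
    have h5 : (c * (n + 1)) ^ (-s - 1) ≤ c ^ (-3 : ℝ) * (1 / ((n + 1 : ℕ) : ℝ) ^ 2) := by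
      rw [Real.mul_rpow hc.le (by positivity), one_div,
        ← Real.rpow_natCast, ← Real.rpow_neg (by positivity)]
      push_cast
      gcongr ?_ * ?_
      · exact Real.rpow_le_rpow_of_exponent_ge hc hc1 (by linarith [hs.2])
      · exact Real.rpow_le_rpow_of_exponent_le (by linarith) (by linarith [hs.1])
    calc _ ≤ s * (c * (n + 1)) ^ (-s - 1) * |n + x - (n + 1 - x)| := by
          refine le_trans ?_ h3
          norm_num
      _ ≤ 2 * (c ^ (-3 : ℝ) * (1 / ((n + 1 : ℕ) : ℝ) ^ 2)) * 1 := by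
          gcongr
          exact hs.2
      _ = bd n := by ring
  have hne (n : ℕ) : (n + x : ℂ) ≠ 0 := by
    have : (n + x : ℝ) ≠ 0 := by have := hx.1; positivity
    exact_mod_cast this
  have hne' (n : ℕ) : (n + 1 - x : ℂ) ≠ 0 := by
    have : (n + 1 - x : ℝ) ≠ 0 := by
      have : (0 : ℝ) ≤ n := n.cast_nonneg
      linarith [hx.2]
    exact_mod_cast this
  have hlim : Tendsto (fun s ↦ ∑' n, f s n) (𝓝[>] 1) (𝓝 (∑' n, f 1 n)) := by
    refine tendsto_tsum_of_dominated_convergence hbd (fun n ↦ ?_) ?_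
    · refine tendsto_nhdsWithin_of_tendsto_nhds (ContinuousAt.tendsto ?_)
      have hcont {z : ℂ} (hz : z ≠ 0) : ContinuousAt (fun s : ℝ ↦ 1 / z ^ (s : ℂ)) 1 :=
        continuousAt_const.div (continuous_ofReal.continuousAt.const_cpow (.inl hz))
          (by simp [hz])
      exact ((hcont (hne n)).sub (hcont (hne' n))).div_const 2
    · filter_upwards [Ioo_mem_nhdsGT (one_lt_two : (1 : ℝ) < 2)] with s hs n
      exact hle ⟨hs.1.le, hs.2.le⟩ n
  have hzeta : Tendsto (fun s : ℝ ↦ ∑' n, f s n) (𝓝[>] 1)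
      (𝓝 (hurwitzZetaOdd (x : UnitAddCircle) 1)) := by
    have hcont : ContinuousAt (fun s : ℝ ↦ hurwitzZetaOdd (x : UnitAddCircle) s) 1 :=
      ((differentiable_hurwitzZetaOdd _).continuous.comp continuous_ofReal).continuousAt
    refine (tendsto_nhdsWithin_of_tendsto_nhds
      (by simpa using hcont.tendsto)).congr' ?_
    filter_upwards [self_mem_nhdsWithin] with s hs
    exact (hasSum_nat_hurwitzZetaOdd_of_mem_Icc ⟨hx.1.le, hx.2.le⟩
      (by simpa using hs)).tsum_eq.symm
  have hsum : HasSum (f 1) (∑' n, f 1 n) :=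
    (hbd.of_norm_bounded (hle ⟨le_rfl, one_le_two⟩)).hasSum
  rw [tendsto_nhds_unique hzeta hlim]
  refine tendsto_nhds_unique hsum.tendsto_sum_nat ?_
  have hxZ : (x : ℂ) ∈ Complex.integerComplement := by
    rintro ⟨m, hm⟩
    have hm' : (m : ℝ) = x := by exact_mod_cast hm
    have h0 : (0 : ℝ) < m := hm' ▸ hx.1
    have h1 : (m : ℝ) < 1 := hm' ▸ hx.2
    norm_cast at h0 h1
    lia
  have hpartial (M : ℕ) : ∑ n ∈ Finset.range M, f 1 n =
      (∑ n ∈ Finset.range M, cotTerm x n + 1 / x - 1 / (M + x)) / 2 := by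
    induction M with
    | zero => simp
    | succ M ih =>
      rw [Finset.sum_range_succ, ih, Finset.sum_range_succ]
      have h1 : (1 : ℂ) / (x - (M + 1)) = -(1 / (M + 1 - x)) := by
        rw [← neg_sub, div_neg]
      simp only [f, cotTerm, ofReal_one, cpow_one, h1]
      push_cast
      rw [add_comm (x : ℂ) (M + 1)]
      ring
  simp only [hpartial]
  have hinv : Tendsto (fun M : ℕ ↦ (1 : ℂ) / (M + x)) atTop (𝓝 0) := by
    have : Tendsto (fun M : ℕ ↦ ((1 / (M + x) : ℝ) : ℂ)) atTop (𝓝 ((0 : ℝ) : ℂ)) :=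
      (continuous_ofReal.tendsto _).comp (tendsto_const_nhds.div_atTop
        (tendsto_atTop_add_const_right _ _ tendsto_natCast_atTop_atTop))
    simpa using this
  convert (((tendsto_logDeriv_euler_cot_sub hxZ).add_const (1 / (x : ℂ))).sub hinv).div_const 2
    using 2
  ring

theorem ZMod.exists_toAddCircle_eq_rat {N : ℕ} [NeZero N] (j : ZMod N) :
    ∃ q : ℚ, (q : ℝ) ∈ Set.Ico (0 : ℝ) 1 ∧ toAddCircle j = ((q : ℝ) : UnitAddCircle) := by
  refine ⟨j.val / N, ?_, by rw [toAddCircle_apply]; push_cast; rfl⟩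
  have hN : (0 : ℝ) < N := Nat.cast_pos.mpr (NeZero.pos N)
  push_cast
  exact ⟨by positivity, (div_lt_one hN).mpr (Nat.cast_lt.mpr j.val_lt)⟩

theorem ZMod.isAlgebraic_LFunction_one_div {N : ℕ} [NeZero N] {Φ : ZMod N → ℂ}
    (hΦ : ∀ j, IsAlgebraic ℚ (Φ j)) (hodd : Φ.Odd) :
    IsAlgebraic ℚ (LFunction Φ 1 / (2 * π * I)) := by
  rw [LFunction_def_odd hodd, mul_div_assoc, Finset.sum_div, cpow_neg_one]
  refine (isAlgebraic_natCast N).inv.mul (isAlgebraic_finsetSum _ fun j _ ↦ ?_)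
  rw [mul_div_assoc]
  refine (hΦ j).mul ?_
  obtain ⟨q, hq, hj⟩ := exists_toAddCircle_eq_rat j
  rw [hj]
  rcases hq.1.eq_or_lt with h0 | h0
  · have h := hurwitzZetaOdd_neg (0 : UnitAddCircle) 1
    rw [neg_zero, self_eq_neg] at h
    rw [← h0, AddCircle.coe_zero, h, zero_div]
    exact isAlgebraic_zero
  · rw [hurwitzZetaOdd_one ⟨h0, hq.2⟩]
    have hπ : (π : ℂ) ≠ 0 := by exact_mod_cast pi_ne_zero
    have : π / 2 * Complex.cot (π * (q : ℝ)) / (2 * π * I) =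
        Complex.cot (π * q) * (((4 : ℕ) : ℂ) * I)⁻¹ := by
      push_cast
      field_simp
      ring
    rw [this]
    exact (isAlgebraic_cot_pi_mul_rat q).mul ((isAlgebraic_natCast 4).mul isAlgebraic_I).inv

theorem ZMod.isAlgebraic_invDFT {N : ℕ} [NeZero N] {Φ : ZMod N → ℂ}
    (hΦ : ∀ j, IsAlgebraic ℚ (Φ j)) (k : ZMod N) : IsAlgebraic ℚ (𝓕⁻ Φ k) := by
  rw [invDFT_apply]
  exact (isAlgebraic_natCast N).inv.mul
    (isAlgebraic_finsetSum _ fun j _ ↦ (isAlgebraic_stdAddChar _).mul (hΦ j))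

theorem ZMod.isAlgebraic_LFunction_div_pow {N : ℕ} [NeZero N] {Φ : ZMod N → ℂ}
    (hΦ : ∀ j, IsAlgebraic ℚ (Φ j)) {k : ℕ} (hk : 2 ≤ k)
    (hpar : ∀ j, Φ (-j) = (-1) ^ k * Φ j) :
    IsAlgebraic ℚ (LFunction Φ k / (2 * π * I) ^ k) := by
  set Ψ := 𝓕⁻ Φ with hΨ
  have hΨpar (j : ZMod N) : Ψ (-j) = (-1) ^ k * Ψ j := by
    simp only [hΨ, invDFT_apply, smul_eq_mul]
    rw [mul_left_comm, Finset.mul_sum _ _ ((-1) ^ k)]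
    refine congrArg ((N : ℂ)⁻¹ * ·) (Fintype.sum_equiv (Equiv.neg (ZMod N)) _ _ fun i ↦ ?_)
    rw [Equiv.neg_apply, hpar, mul_neg, neg_mul, mul_left_comm, ← mul_assoc ((-1) ^ k),
      ← mul_pow]
    simp
  have hL : LFunction Φ k = ∑ j, Ψ j * expZeta (toAddCircle (-j)) k := by
    have hk1 : (k : ℂ) ≠ 1 := by
      norm_cast
      lia
    rw [← LFunction_dft Ψ (.inr hk1), hΨ, LinearEquiv.apply_symm_apply]
  have hL' : LFunction Φ k = ∑ j, Ψ j * ((-1) ^ k * expZeta (-toAddCircle (-j)) k) := by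
    rw [hL]
    refine Fintype.sum_equiv (Equiv.neg (ZMod N)) _ _ fun i ↦ ?_
    rw [Equiv.neg_apply, hΨpar, neg_neg, map_neg, mul_mul_mul_comm, ← mul_pow]
    simp
  have key : LFunction Φ k / (2 * π * I) ^ k = ((2 : ℕ) : ℂ)⁻¹ * ∑ j, Ψ j *
      ((expZeta (toAddCircle (-j)) k + (-1) ^ k * expZeta (-toAddCircle (-j)) k) /
        (2 * π * I) ^ k) := by
    simp only [mul_div_assoc', mul_add, ← Finset.sum_div, Finset.sum_add_distrib]
    rw [← hL, ← hL']
    push_cast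
    ring
  rw [key]
  refine (isAlgebraic_natCast 2).inv.mul (isAlgebraic_finsetSum _ fun j _ ↦
    (isAlgebraic_invDFT hΦ j).mul ?_)
  obtain ⟨q, hq, hj⟩ := exists_toAddCircle_eq_rat (-j)
  rw [hj, expZeta_add_expZeta_neg hk ⟨hq.1, hq.2.le⟩]
  have : -(2 * π * I) ^ k / k ! * bernoulliFun k q / (2 * π * I) ^ k =
      -((k ! : ℂ)⁻¹ * bernoulliFun k q) := by
    have := pow_ne_zero k two_pi_I_ne_zero
    field_simp
  rw [this]
  exact ((isAlgebraic_natCast _).inv.mul (isAlgebraic_bernoulliFun_rat k q)).neg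

end

/-- Let `ρ` be a Dirichlet character modulo `N` with values in `ℂ` and `k ≥ 1` an integer
with `ρ(−1) = (−1)^k`. Then `L(ρ, k)/(2πi)^k` is algebraic (the case `L = ℚ` of the
Siegel–Klingen theorem on critical Hecke `L`-values). -/
theorem dirichlet_critical_value_algebraic
    {N : ℕ} [NeZero N] (ρ : DirichletCharacter ℂ N) (k : ℕ) (hk : 1 ≤ k)
    (hpar : ρ (-1) = (-1) ^ k) :
    IsAlgebraic ℚ (DirichletCharacter.LFunction ρ k / (2 * π * I) ^ k) := by
  have hneg (j : ZMod N) : ρ (-j) = (-1) ^ k * ρ j := by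
    rw [← neg_one_mul, map_mul, hpar]
  rcases hk.eq_or_lt with rfl | hk
  · simpa using! ZMod.isAlgebraic_LFunction_one_div ρ.isAlgebraic_apply
      (fun j ↦ by simpa using hneg j)
  · exact ZMod.isAlgebraic_LFunction_div_pow ρ.isAlgebraic_apply hk hneg
end
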